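/- The infinite product C := ∏_p (1 − (p² − p − 1)/((p−1)³(p+1))), taken over all primes p, converges to a positive real number, and as z → ∞ one has ∏_{p < z} (1 − (p² − 2)/((p−1)(p²−1))) = (C·e^{−γ}/log z)·(1 + O(1/log z)), where γ is the Euler–Mascheroni constant. That is, there exist constants A > 0 and z₀ such that for all z ≥ z₀, |∏_{p < z} (1 − (p² − 2)/((p−1)(p²−1))) − C·e^{−γ}/log z| ≤ A·C·e^{−γ}/(log z)². -/

import Mathlib

open Filter

lemma mt_log_factorial (n : ℕ) : Real.log (n.factorial : ℝ) =
    ∑ p ∈ (n+1).primesBelow, (n.factorial.factorization p : ℝ) * Real.log p := by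
  conv_lhs => rw [← Nat.prod_factorization_pow_eq_self n.factorial_ne_zero]
  rw [Finsupp.prod_of_support_subset (s := (n+1).primesBelow)]
  · push_cast
    rw [Real.log_prod]
    · simp
    · intro p hp
      have := (Nat.mem_primesBelow.1 hp).2.pos
      positivity
  · intro p hp
    simp only [Nat.support_factorization, Nat.mem_primeFactors] at hp
    rw [Nat.mem_primesBelow]
    exact ⟨Nat.lt_succ_of_le ((hp.1.dvd_factorial).1 hp.2.1), hp.1⟩
  · simp

lemma mt_fact_lower {p n : ℕ} (hp : p.Prime) : (n:ℝ)/p - 1 ≤ (n.factorial.factorization p : ℝ) := by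
  have h1 : n / p ≤ n.factorial.factorization p := by
    rw [Nat.factorization_factorial hp (b := Nat.log p n + 2) (by omega)]
    have := Finset.single_le_sum (f := fun i => n / p ^ i) (s := Finset.Ico 1 (Nat.log p n + 2))
      (fun _ _ => Nat.zero_le _) (a := 1) (by simp)
    simpa using this
  have h2 : (n:ℝ)/p < (n/p : ℕ) + 1 := by
    have := Nat.lt_floor_add_one ((n:ℝ)/p)
    rwa [Nat.floor_div_eq_div] at this
  have h3 : ((n/p : ℕ):ℝ) ≤ (n.factorial.factorization p : ℝ) := by exact_mod_cast h1
  linarith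

lemma mt_fact_upper {p n : ℕ} (hp : p.Prime) :
    (n.factorial.factorization p : ℝ) ≤ (n:ℝ)/p + n / (p * (p - 1)) := by
  have := Fact.mk hp
  have h := sub_one_mul_padicValNat_factorial (p := p) n
  rw [← Nat.factorization_def _ hp] at h
  have h1 : (p-1) * n.factorial.factorization p ≤ n := by omega
  have h2 : ((p:ℝ)-1) * n.factorial.factorization p ≤ n := by
    have : (((p-1) * n.factorial.factorization p : ℕ):ℝ) ≤ n := by exact_mod_cast h1
    rwa [Nat.cast_mul, Nat.cast_sub hp.one_le, Nat.cast_one] at this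
  have hp2 : (2:ℝ) ≤ p := by exact_mod_cast hp.two_le
  have h3 : (n:ℝ)/p + n / (p * (p - 1)) = n / (p-1) := by
    have : (p:ℝ) - 1 ≠ 0 := by linarith
    field_simp
    ring
  rw [h3, le_div_iff₀ (by linarith)]
  linarith

lemma mt_summable_log : Summable (fun n : ℕ => Real.log n / ((n:ℝ) * (n - 1))) := by
  have : Summable (fun n : ℕ => 4 * (n:ℝ) ^ (-(3/2:ℝ))) :=
    (Real.summable_nat_rpow.2 (by norm_num)).mul_left 4
  refine Summable.of_nonneg_of_le ?_ ?_ this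
  · intro n
    rcases Nat.eq_zero_or_pos n with rfl | hn
    · simp
    have : (1:ℝ) ≤ n := by exact_mod_cast hn
    exact div_nonneg (Real.log_nonneg this) (mul_nonneg (by linarith) (by linarith))
  · intro n
    rcases Nat.lt_or_ge n 2 with hn | hn
    · interval_cases n <;> simp
    have hn2 : (2:ℝ) ≤ n := by exact_mod_cast hn
    have h0 : (0:ℝ) < n := by linarith
    have h1 := Real.log_le_rpow_div h0.le (ε := 1/2) (by norm_num)
    rw [div_le_iff₀ (mul_pos h0 (by linarith))]
    have h2 : (n:ℝ) ^ (-(3/2:ℝ)) * (n * n) = (n:ℝ)^(1/2:ℝ) := by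
      have : (n:ℝ) * n = (n:ℝ)^(2:ℝ) := by norm_num; ring
      rw [this, ← Real.rpow_add h0]; norm_num
    have h3 : 0 < (n:ℝ) ^ (-(3/2:ℝ)) := by positivity
    have h4 : (n:ℝ) * n ≤ 2 * (n * (n-1)) := by nlinarith
    calc Real.log n ≤ 2 * (n:ℝ)^(1/2:ℝ) := by linarith
      _ = 2 * ((n:ℝ) ^ (-(3/2:ℝ)) * (n * n)) := by rw [h2]
      _ ≤ 2 * ((n:ℝ) ^ (-(3/2:ℝ)) * (2 * (n * (n-1)))) := by gcongr
      _ = _ := by ring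

lemma mt_first : ∃ K : ℝ, 0 < K ∧ ∀ n : ℕ, 1 ≤ n →
    |∑ p ∈ (n+1).primesBelow, Real.log p / (p:ℝ) - Real.log n| ≤ K := by
  set T := ∑' n : ℕ, Real.log n / ((n:ℝ) * (n - 1)) with hT
  have hT0 : ∀ n : ℕ, 0 ≤ Real.log n / ((n:ℝ) * (n - 1)) := by
    intro n
    rcases Nat.eq_zero_or_pos n with rfl | hn
    · simp
    have : (1:ℝ) ≤ n := by exact_mod_cast hn
    exact div_nonneg (Real.log_nonneg this) (mul_nonneg (by linarith) (by linarith))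
  have hTn : 0 ≤ T := tsum_nonneg hT0
  have hl4 : 0 < Real.log 4 := Real.log_pos (by norm_num)
  refine ⟨1 + T + Real.log 4, by linarith, fun n hn => ?_⟩
  have hn0 : (0:ℝ) < n := by exact_mod_cast hn
  have hn1 : (1:ℝ) ≤ n := by exact_mod_cast hn
  have hlog0 : ∀ p ∈ (n+1).primesBelow, 0 ≤ Real.log (p:ℝ) := fun p hp => by
    have := (Nat.mem_primesBelow.1 hp).2.one_le
    exact Real.log_nonneg (by exact_mod_cast this)
  have hup : Real.log (n.factorial : ℝ) ≤ n * Real.log n := by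
    rw [← Real.log_pow]
    apply Real.log_le_log (by positivity)
    exact_mod_cast Nat.factorial_le_pow n
  have hlow : n * Real.log n - n ≤ Real.log (n.factorial : ℝ) := by
    have := Stirling.le_log_factorial_stirling (n := n) (by omega)
    have h1 : 0 ≤ Real.log n := Real.log_nonneg hn1
    have h2 : 0 ≤ Real.log (2 * Real.pi) := Real.log_nonneg (by nlinarith [Real.pi_gt_three])
    linarith
  have htheta : ∑ p ∈ (n+1).primesBelow, Real.log (p:ℝ) ≤ Real.log 4 * n := by
    have := Chebyshev.theta_le_log4_mul_x hn0.le
    rw [Chebyshev.theta_eq_sum_primesLE_log] at this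
    exact this
  have hA : n * (∑ p ∈ (n+1).primesBelow, Real.log p / (p:ℝ)) - Real.log 4 * n
      ≤ Real.log (n.factorial : ℝ) := by
    rw [mt_log_factorial]
    have : ∑ p ∈ (n+1).primesBelow, ((n:ℝ)/p - 1) * Real.log p ≤
      ∑ p ∈ (n+1).primesBelow, (n.factorial.factorization p : ℝ) * Real.log p :=
      Finset.sum_le_sum fun p hp => mul_le_mul_of_nonneg_right
        (mt_fact_lower (Nat.mem_primesBelow.1 hp).2) (hlog0 p hp)
    have h2 : ∑ p ∈ (n+1).primesBelow, ((n:ℝ)/p - 1) * Real.log p =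
      n * (∑ p ∈ (n+1).primesBelow, Real.log p / (p:ℝ)) - ∑ p ∈ (n+1).primesBelow, Real.log (p:ℝ) := by
      rw [Finset.mul_sum, ← Finset.sum_sub_distrib]
      exact Finset.sum_congr rfl fun p _ => by ring
    linarith
  have hB : Real.log (n.factorial : ℝ) ≤
      n * (∑ p ∈ (n+1).primesBelow, Real.log p / (p:ℝ)) + n * T := by
    rw [mt_log_factorial]
    have : ∑ p ∈ (n+1).primesBelow, (n.factorial.factorization p : ℝ) * Real.log p ≤
      ∑ p ∈ (n+1).primesBelow, ((n:ℝ)/p + n / (p * (p - 1))) * Real.log p :=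
      Finset.sum_le_sum fun p hp => mul_le_mul_of_nonneg_right
        (mt_fact_upper (Nat.mem_primesBelow.1 hp).2) (hlog0 p hp)
    have h2 : ∑ p ∈ (n+1).primesBelow, ((n:ℝ)/p + n / (p * (p - 1))) * Real.log p =
      n * (∑ p ∈ (n+1).primesBelow, Real.log p / (p:ℝ)) +
        n * ∑ p ∈ (n+1).primesBelow, Real.log p / ((p:ℝ) * (p - 1)) := by
      rw [Finset.mul_sum, Finset.mul_sum, ← Finset.sum_add_distrib]
      exact Finset.sum_congr rfl fun p _ => by ring
    have h3 : ∑ p ∈ (n+1).primesBelow, Real.log p / ((p:ℝ) * (p - 1)) ≤ T :=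
      mt_summable_log.sum_le_tsum _ (fun i _ => hT0 i)
    have := mul_le_mul_of_nonneg_left h3 hn0.le
    linarith
  rw [abs_le]
  constructor
  · have : n * (Real.log n - 1 - T) ≤ n * (∑ p ∈ (n+1).primesBelow, Real.log p / (p:ℝ)) := by
      linarith
    have := le_of_mul_le_mul_left this hn0
    linarith
  · have : n * (∑ p ∈ (n+1).primesBelow, Real.log p / (p:ℝ)) ≤ n * (Real.log n + Real.log 4) := by
      linarith
    have := le_of_mul_le_mul_left this hn0
    linarith

lemma mt_limit (D w : ℕ → ℝ) (hw : Tendsto w atTop (nhds 0))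
    (h : ∀ n, |D (n+1) - D n| ≤ w n - w (n+1)) : ∃ M, ∀ n, |D n - M| ≤ w n := by
  have hanti : Antitone (fun n => D n + w n) := antitone_nat_of_succ_le fun n => by
    have := (abs_le.1 (h n)).2; linarith
  have hmono : Monotone (fun n => D n - w n) := monotone_nat_of_le_succ fun n => by
    have := (abs_le.1 (h n)).1; linarith
  have hwa : Antitone w := antitone_nat_of_succ_le fun n => by
    have := (abs_nonneg _).trans (h n); linarith
  have hw0 : ∀ n, 0 ≤ w n := fun n => hwa.le_of_tendsto hw n
  have hbdd : BddAbove (Set.range fun n => D n - w n) := by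
    refine ⟨D 0 + w 0, ?_⟩
    rintro _ ⟨n, rfl⟩
    have := hanti (Nat.zero_le n)
    have := hw0 n
    simp only at *
    linarith
  have h1 := tendsto_atTop_ciSup hmono hbdd
  set M := ⨆ n, D n - w n
  have h2 : Tendsto (fun n => D n + w n) atTop (nhds M) := by
    have := h1.add (hw.add hw)
    simp only [add_zero] at this
    refine this.congr fun n => by ring
  refine ⟨M, fun n => ?_⟩
  have h3 := hmono.ge_of_tendsto h1 n
  have h4 := hanti.le_of_tendsto h2 n
  rw [abs_le]; constructor <;> linarith

/-- Mertens second theorem, with unspecified constant. -/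
lemma mt_second : ∃ M K : ℝ, 0 < K ∧ ∀ n : ℕ, 2 ≤ n →
    |∑ p ∈ (n+1).primesBelow, 1 / (p:ℝ) - Real.log (Real.log n) - M| ≤ K / Real.log n := by
  obtain ⟨K, hK, hR⟩ := mt_first
  set L : ℕ → ℝ := fun n => ∑ p ∈ (n+1).primesBelow, Real.log p / (p:ℝ) with hL
  set S : ℕ → ℝ := fun n => ∑ p ∈ (n+1).primesBelow, 1 / (p:ℝ) with hS
  set D : ℕ → ℝ := fun n => S (n+2) - Real.log (Real.log (n+2:ℕ)) -
    (L (n+2) - Real.log (n+2:ℕ)) / Real.log (n+2:ℕ) with hD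
  set w : ℕ → ℝ := fun n => (K+1) / Real.log (n+2:ℕ) with hw
  have hwt : Tendsto w atTop (nhds 0) := by
    apply Tendsto.const_div_atTop
    exact Real.tendsto_log_atTop.comp (tendsto_natCast_atTop_atTop.comp (tendsto_add_atTop_nat 2))
  have hstep : ∀ n, |D (n+1) - D n| ≤ w n - w (n+1) := by
    intro n
    have ha : 0 < Real.log (n+2:ℕ) := Real.log_pos (by push_cast; linarith [n.cast_nonneg (α := ℝ)])
    have hab : Real.log (n+2:ℕ) ≤ Real.log (n+1+2:ℕ) :=
      Real.log_le_log (by positivity) (by push_cast; linarith)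
    have hba : Real.log (n+1+2:ℕ) - Real.log (n+2:ℕ) ≤ 1 := by
      rw [← Real.log_div (by positivity) (by positivity)]
      have h0 : (0:ℝ) < (n+2:ℕ) := by positivity
      refine (Real.log_le_sub_one_of_pos (by positivity)).trans ?_
      rw [sub_le_iff_le_add, div_le_iff₀ h0]
      push_cast; linarith [n.cast_nonneg (α := ℝ)]
    have hr := hR (n+2) (by omega)
    have hLS : L (n+1+2) - L (n+2) = Real.log (n+1+2:ℕ) * (S (n+1+2) - S (n+2)) := by
      simp only [hL, hS]
      have e : n + 1 + 2 + 1 = (n+2+1) + 1 := by ring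
      rw [e, Nat.primesBelow_succ (n+2+1)]
      split_ifs with hp
      · rw [Finset.sum_insert (Nat.notMem_primesBelow _), Finset.sum_insert (Nat.notMem_primesBelow _)]
        have : n + 1 + 2 = n + 2 + 1 := by ring
        rw [this]
        ring
      · simp
    change |L (n+2) - Real.log (n+2:ℕ)| ≤ K at hr
    simp only [hD, hw]
    generalize Real.log (n+2:ℕ) = a at *
    generalize Real.log (n+1+2:ℕ) = b at *
    have hb : 0 < b := by linarith
    have hl1 : Real.log b - Real.log a ≤ (b - a) / a := by
      rw [← Real.log_div hb.ne' ha.ne']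
      refine (Real.log_le_sub_one_of_pos (by positivity)).trans (le_of_eq ?_)
      field_simp
    have hl2 : (b - a) / b ≤ Real.log b - Real.log a := by
      have : Real.log a - Real.log b ≤ (a - b) / b := by
        rw [← Real.log_div ha.ne' hb.ne']
        refine (Real.log_le_sub_one_of_pos (by positivity)).trans (le_of_eq ?_)
        field_simp
      have e : (a - b)/b = - ((b-a)/b) := by ring
      linarith
    have hS' : S (n+1+2) - S (n+2) = (L (n+1+2) - L (n+2)) / b := by
      rw [hLS]; field_simp
    have hinv : 0 ≤ 1/a - 1/b := by
      have := one_div_le_one_div_of_le ha hab; linarith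
    have key : S (n + 1 + 2) - Real.log b - (L (n + 1 + 2) - b) / b -
        (S (n + 2) - Real.log a - (L (n + 2) - a) / a) =
        ((b - a)/b - (Real.log b - Real.log a)) + (L (n+2) - a) * (1/a - 1/b) := by
      have : S (n+1+2) = S (n+2) + (L (n+1+2) - L (n+2)) / b := by linarith
      rw [this]; field_simp; ring
    rw [key]
    have h1 : |(L (n+2) - a) * (1/a - 1/b)| ≤ K * (1/a - 1/b) := by
      rw [abs_mul, abs_of_nonneg hinv]
      exact mul_le_mul_of_nonneg_right hr hinv
    have h2 : |(b - a)/b - (Real.log b - Real.log a)| ≤ 1 * (1/a - 1/b) := by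
      rw [abs_of_nonpos (by linarith)]
      have e : (b-a)/a - (b-a)/b = (b-a) * (1/a-1/b) := by ring
      have := mul_le_mul_of_nonneg_right hba hinv
      linarith
    calc _ ≤ _ := abs_add_le _ _
      _ ≤ 1 * (1/a - 1/b) + K * (1/a - 1/b) := add_le_add h2 h1
      _ = _ := by ring
  obtain ⟨M, hM⟩ := mt_limit D w hwt hstep
  refine ⟨M, 2*K+1, by linarith, fun n hn => ?_⟩
  obtain ⟨m, rfl⟩ : ∃ m, n = m + 2 := ⟨n - 2, by omega⟩
  have h := hM m
  have hr := hR (m+2) (by omega)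
  change |L (m+2) - Real.log (m+2:ℕ)| ≤ K at hr
  change |S (m+2) - Real.log (Real.log (m+2:ℕ)) - M| ≤ _
  have ha : 0 < Real.log (m+2:ℕ) := Real.log_pos (by push_cast; linarith [m.cast_nonneg (α := ℝ)])
  simp only [hD, hw] at h
  have h1 : |(L (m+2) - Real.log (m+2:ℕ)) / Real.log (m+2:ℕ)| ≤ K / Real.log (m+2:ℕ) := by
    rw [abs_div, abs_of_pos ha]
    gcongr
  have e : S (m+2) - Real.log (Real.log (m+2:ℕ)) - M =
    (S (m+2) - Real.log (Real.log (m+2:ℕ)) -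
      (L (m+2) - Real.log (m+2:ℕ)) / Real.log (m+2:ℕ) - M) +
      (L (m+2) - Real.log (m+2:ℕ)) / Real.log (m+2:ℕ) := by ring
  rw [e]
  refine (abs_add_le _ _).trans ((add_le_add h h1).trans (le_of_eq ?_))
  ring

lemma mt_int_log : MeasureTheory.IntegrableOn (fun t : ℝ => Real.exp (-t) * Real.log t) (Set.Ioi 0) := by
  have h1 := Real.GammaIntegral_convergent (s := 1/2) (by norm_num)
  have h2 := Real.GammaIntegral_convergent (s := 2) (by norm_num)
  refine ((h1.const_mul 2).add h2).mono' ?_ ?_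
  · exact ((by fun_prop : Measurable (fun t : ℝ => Real.exp (-t) * Real.log t))).aestronglyMeasurable
  · filter_upwards [MeasureTheory.ae_restrict_mem measurableSet_Ioi] with t ht
    have ht : 0 < t := ht
    have e1 := Real.exp_pos (-t)
    have ea : |Real.log t| ≤ 2 * t ^ ((1/2:ℝ)-1) + t ^ ((2:ℝ)-1) := by
      have hp : 0 < t ^ ((1/2:ℝ)-1) := by positivity
      have hq : t ^ ((2:ℝ)-1) = t := by norm_num
      rw [hq, abs_le]
      constructor
      · have := Real.log_le_rpow_div (inv_pos.2 ht).le (ε := 1/2) (by norm_num)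
        rw [Real.log_inv, Real.inv_rpow ht.le, ← Real.rpow_neg ht.le] at this
        have e : (1/2:ℝ) - 1 = -(1/2) := by norm_num
        rw [e]
        linarith
      · have := Real.log_le_sub_one_of_pos ht
        linarith
    simp only [Pi.add_apply, Real.norm_eq_abs, abs_mul, abs_of_pos e1]
    calc _ ≤ Real.exp (-t) * (2 * t ^ ((1/2:ℝ)-1) + t ^ ((2:ℝ)-1)) := by gcongr
      _ = _ := by ring

lemma mt_int_exp : MeasureTheory.IntegrableOn (fun t : ℝ => Real.exp (-t)) (Set.Ioi 0) := by
  simpa using Real.GammaIntegral_convergent (s := 1) (by norm_num)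

lemma mt_gamma : ∫ t in Set.Ioi (0:ℝ), Real.exp (-t) * Real.log t = -Real.eulerMascheroniConstant := by
  have h := Complex.hasDerivAt_GammaIntegral (s := 1) (by norm_num)
  have h2 : HasDerivAt Complex.Gamma (∫ (t : ℝ) in Set.Ioi 0,
      (t:ℂ) ^ ((1:ℂ) - 1) * (↑(Real.log t) * ↑(Real.exp (-t)))) 1 := by
    refine h.congr_of_eventuallyEq ?_
    have : {s : ℂ | 0 < s.re} ∈ nhds (1:ℂ) :=
      (isOpen_lt continuous_const Complex.continuous_re).mem_nhds (by simp)
    filter_upwards [this] with s hs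
    exact Complex.Gamma_eq_integral hs
  have h3 := h2.unique Complex.hasDerivAt_Gamma_one
  have h4 : (∫ (t : ℝ) in Set.Ioi 0, (t:ℂ) ^ ((1:ℂ) - 1) * (↑(Real.log t) * ↑(Real.exp (-t)))) =
    ((∫ t in Set.Ioi (0:ℝ), Real.exp (-t) * Real.log t : ℝ) : ℂ) := by
    rw [← integral_complex_ofReal]
    congr 1
    ext t
    simp [mul_comm]
  rw [h4] at h3
  exact_mod_cast h3

lemma mt_laplace (ε : ℝ) (hε : 0 < ε) :
    MeasureTheory.IntegrableOn (fun t : ℝ => Real.exp (-t) *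
      ∑ p ∈ (⌊Real.exp (t/ε)⌋₊+1).primesBelow, 1 / (p:ℝ)) (Set.Ioi 0) ∧
    ∑' p : Nat.Primes, (p:ℝ) ^ (-(1+ε)) = ∫ t in Set.Ioi (0:ℝ), Real.exp (-t) *
      ∑ p ∈ (⌊Real.exp (t/ε)⌋₊+1).primesBelow, 1 / (p:ℝ) := by
  set F : Nat.Primes → ℝ → ℝ := fun p t =>
    (Set.Ici (ε * Real.log p)).indicator (fun t => Real.exp (-t) * (1 / (p:ℝ))) t with hF
  have hlog : ∀ p : Nat.Primes, 0 < ε * Real.log p := fun p =>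
    mul_pos hε (Real.log_pos (by exact_mod_cast p.2.one_lt))
  have hp0 : ∀ p : Nat.Primes, (0:ℝ) < p := fun p => by exact_mod_cast p.2.pos
  have hFint : ∀ p, MeasureTheory.Integrable (F p) (MeasureTheory.volume.restrict (Set.Ioi 0)) := by
    intro p
    exact MeasureTheory.Integrable.indicator (mt_int_exp.mul_const _) measurableSet_Ici
  have hFnn : ∀ p t, 0 ≤ F p t := fun p t => Set.indicator_nonneg (fun _ _ => by positivity) _
  have hFval : ∀ p, ∫ t in Set.Ioi (0:ℝ), F p t = (p:ℝ) ^ (-(1+ε)) := by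
    intro p
    simp only [hF]
    rw [MeasureTheory.setIntegral_indicator measurableSet_Ici]
    have : Set.Ioi (0:ℝ) ∩ Set.Ici (ε * Real.log p) = Set.Ici (ε * Real.log p) := by
      apply Set.inter_eq_right.2
      intro t ht
      exact lt_of_lt_of_le (hlog p) ht
    rw [this, MeasureTheory.integral_Ici_eq_integral_Ioi, MeasureTheory.integral_mul_const,
      integral_exp_neg_Ioi, Real.rpow_def_of_pos (hp0 p)]
    have : (1:ℝ) / p = Real.exp (-Real.log p) := by
      rw [Real.exp_neg, Real.exp_log (hp0 p)]; simp
    rw [this, ← Real.exp_add]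
    congr 1; ring
  have hsum : Summable fun p : Nat.Primes => (p:ℝ) ^ (-(1+ε)) :=
    Nat.Primes.summable_rpow.2 (by linarith)
  have hsumn : Summable fun p => ∫ t in Set.Ioi (0:ℝ), ‖F p t‖ := by
    refine hsum.congr fun p => ?_
    rw [← hFval p]
    congr 1; ext t
    rw [Real.norm_of_nonneg (hFnn p t)]
  have hts : ∀ t, ∑' p, F p t = Real.exp (-t) *
      ∑ p ∈ (⌊Real.exp (t/ε)⌋₊+1).primesBelow, 1 / (p:ℝ) := by
    intro t
    have hiff : ∀ p : Nat.Primes, ε * Real.log p ≤ t ↔ (p:ℕ) ∈ (⌊Real.exp (t/ε)⌋₊+1).primesBelow := by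
      intro p
      rw [Nat.mem_primesBelow, Nat.lt_succ_iff, Nat.le_floor_iff (Real.exp_pos _).le,
        ← Real.log_le_iff_le_exp (hp0 p), le_div_iff₀ hε, mul_comm]
      simp [p.2]
    have : ∀ p : Nat.Primes, F p t = (fun n : ℕ => if n ∈ (⌊Real.exp (t/ε)⌋₊+1).primesBelow then
        Real.exp (-t) * (1 / (n:ℝ)) else 0) p := by
      intro p
      simp only [hF, Set.indicator_apply, Set.mem_Ici, hiff]
    rw [tsum_congr this, Finset.mul_sum]
    refine (tsum_subtype {p : ℕ | p.Prime} (fun n : ℕ => if n ∈ (⌊Real.exp (t/ε)⌋₊+1).primesBelow then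
        Real.exp (-t) * (1 / (n:ℝ)) else 0)).trans ?_
    rw [tsum_eq_sum (s := (⌊Real.exp (t/ε)⌋₊+1).primesBelow)]
    · refine Finset.sum_congr rfl fun p hp => ?_
      rw [Set.indicator_of_mem (show p ∈ {p : ℕ | p.Prime} from (Nat.mem_primesBelow.1 hp).2), if_pos hp]
    · intro b hb
      simp [hb]
  have h := MeasureTheory.hasSum_integral_of_summable_integral_norm hFint hsumn
  have hI : MeasureTheory.Integrable (fun t => ∑' p, F p t)
      (MeasureTheory.volume.restrict (Set.Ioi 0)) := by
    by_contra hcon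
    rw [MeasureTheory.integral_undef hcon] at h
    have h2 := h.tsum_eq
    simp only [hFval] at h2
    have : 0 < ∑' p : Nat.Primes, (p:ℝ) ^ (-(1+ε)) :=
      hsum.tsum_pos (fun p => by positivity) ⟨2, Nat.prime_two⟩ (by positivity)
    linarith
  simp only [hts] at h hI
  refine ⟨hI, ?_⟩
  rw [← h.tsum_eq]
  simp only [hFval]

lemma mt_zeta (s : ℝ) (hs : 1 < s) (hsum : Summable fun p : Nat.Primes => -Real.log (1 - (p:ℝ) ^ (-s))) :
    ∑' p : Nat.Primes, -Real.log (1 - (p:ℝ) ^ (-s)) = Real.log (∑' n : ℕ, 1 / (n:ℝ)^s) := by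
  let f : ℕ →*₀ ℝ :=
    { toFun := fun n => (n:ℝ) ^ (-s)
      map_zero' := by simp [Real.zero_rpow (by linarith : -s ≠ 0)]
      map_one' := by simp
      map_mul' := fun a b => by
        push_cast; exact Real.mul_rpow (by positivity) (by positivity) }
  have hf : Summable (fun n => ‖f n‖) := by
    have : Summable (fun n : ℕ => (n:ℝ) ^ (-s)) := Real.summable_nat_rpow.2 (by linarith)
    refine this.congr fun n => ?_
    rw [Real.norm_of_nonneg]
    · rfl
    · exact Real.rpow_nonneg (by positivity) _
  have h := EulerProduct.eulerProduct_completely_multiplicative_hasProd hf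
  have h2 := hsum.hasSum.rexp
  have h3 : (Real.exp ∘ fun p : Nat.Primes => -Real.log (1 - (p:ℝ) ^ (-s))) =
      fun p : Nat.Primes => (1 - f p)⁻¹ := by
    ext p
    have hp : (1:ℝ) < p := by exact_mod_cast p.2.one_lt
    have : (p:ℝ) ^ (-s) < 1 := Real.rpow_lt_one_of_one_lt_of_neg hp (by linarith)
    simp only [Function.comp, Real.exp_neg]
    rw [Real.exp_log (by linarith)]
    rfl
  rw [h3] at h2
  have h4 := h2.unique h
  have h5 : ∑' n : ℕ, 1 / (n:ℝ)^s = ∑' n, f n := tsum_congr fun n => by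
    change _ = (n:ℝ) ^ (-s)
    rw [Real.rpow_neg (by positivity)]; simp
  rw [h5, ← h4, Real.log_exp]

lemma mt_E {M K : ℝ} (hK : 0 < K) (h : ∀ n : ℕ, 2 ≤ n →
    |∑ p ∈ (n+1).primesBelow, 1 / (p:ℝ) - Real.log (Real.log n) - M| ≤ K / Real.log n)
    (u : ℝ) (n : ℕ) (hn2 : 2 ≤ n) (hn : (n:ℝ) ≤ Real.exp u) (hn' : Real.exp u ≤ n + 1) :
    |∑ p ∈ (n+1).primesBelow, 1 / (p:ℝ) - Real.log u - M| ≤ 2 * (K+1) / u := by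
  have hn2' : (2:ℝ) ≤ n := by exact_mod_cast hn2
  have hn0 : (0:ℝ) < n := by linarith
  have hl0 : 0 < Real.log n := Real.log_pos (by linarith)
  have h1 : Real.log n ≤ u := (Real.log_le_iff_le_exp hn0).2 hn
  have hu : 0 < u := by linarith
  have h2 : u ≤ Real.log (n+1) := (Real.le_log_iff_exp_le (by linarith)).2 hn'
  have h3 : Real.log (n+1:ℝ) ≤ Real.log n + 1 := by
    have : Real.log (n+1:ℝ) - Real.log n ≤ 1 := by
      rw [← Real.log_div (by positivity) (by positivity)]
      refine (Real.log_le_sub_one_of_pos (by positivity)).trans ?_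
      rw [sub_le_iff_le_add, div_le_iff₀ hn0]
      linarith
    linarith
  have h4 : Real.log (n+1:ℝ) ≤ 2 * Real.log n := by
    have : 2 * Real.log (n:ℝ) = Real.log ((n:ℝ)^2) := by rw [Real.log_pow]; norm_num
    rw [this]
    exact Real.log_le_log (by linarith) (by nlinarith)
  have h5 : |Real.log (Real.log n) - Real.log u| ≤ 1 / Real.log n := by
    rw [abs_sub_comm, abs_of_nonneg (sub_nonneg.2 (Real.log_le_log hl0 h1)),
      ← Real.log_div hu.ne' hl0.ne']
    refine (Real.log_le_sub_one_of_pos (by positivity)).trans ?_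
    rw [sub_le_iff_le_add, div_add_one hl0.ne']
    gcongr
    linarith
  have e : ∑ p ∈ (n+1).primesBelow, 1 / (p:ℝ) - Real.log u - M =
    (∑ p ∈ (n+1).primesBelow, 1 / (p:ℝ) - Real.log (Real.log n) - M) +
      (Real.log (Real.log n) - Real.log u) := by ring
  rw [e]
  refine (abs_add_le _ _).trans ((add_le_add (h n hn2) h5).trans ?_)
  rw [← add_div, div_le_div_iff₀ hl0 hu]
  nlinarith

lemma mt_E' {M K : ℝ} (hK : 0 < K) (h : ∀ n : ℕ, 2 ≤ n →
    |∑ p ∈ (n+1).primesBelow, 1 / (p:ℝ) - Real.log (Real.log n) - M| ≤ K / Real.log n)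
    (u : ℝ) (hu : Real.log 2 ≤ u) :
    |∑ p ∈ (⌊Real.exp u⌋₊+1).primesBelow, 1 / (p:ℝ) - Real.log u - M| ≤ 2 * (K+1) / u := by
  refine mt_E hK h u _ ?_ (Nat.floor_le (Real.exp_pos _).le) (Nat.lt_floor_add_one _).le
  apply Nat.le_floor
  push_cast
  exact (Real.log_le_iff_le_exp (by norm_num)).1 hu

lemma mt_limit_primes {M K : ℝ} (hK : 0 < K) (h : ∀ n : ℕ, 2 ≤ n →
    |∑ p ∈ (n+1).primesBelow, 1 / (p:ℝ) - Real.log (Real.log n) - M| ≤ K / Real.log n) :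
    Tendsto (fun ε : ℝ => ∑' p : Nat.Primes, (p:ℝ) ^ (-(1+ε)) + Real.log ε) (nhdsWithin 0 (Set.Ioi 0))
      (nhds (M - Real.eulerMascheroniConstant)) := by
  set S : ℝ → ℝ := fun u => ∑ p ∈ (⌊Real.exp u⌋₊+1).primesBelow, 1 / (p:ℝ) with hS
  have hSE : ∀ u, Real.log 2 ≤ u → |S u - Real.log u - M| ≤ 2 * (K+1) / u := mt_E' hK h
  have hS0 : ∀ u, u < Real.log 2 → S u = 0 := by
    intro u hu
    have h1 : ⌊Real.exp u⌋₊ < 2 := by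
      rw [Nat.floor_lt (Real.exp_pos _).le]
      push_cast
      exact (Real.lt_log_iff_exp_lt (by norm_num)).1 hu
    apply Finset.sum_eq_zero
    intro p hp
    have := Nat.mem_primesBelow.1 hp
    have := this.2.two_le
    omega
  have hl2 : 0 < Real.log 2 := Real.log_pos (by norm_num)
  have hl2' : Real.log 2 < 1 := by linarith [Real.log_two_lt_d9]
  have hinteg : ∀ ε : ℝ, 0 < ε → MeasureTheory.IntegrableOn
      (fun t : ℝ => Real.exp (-t) * (S (t/ε) - Real.log (t/ε))) (Set.Ioi 0) ∧
      ∑' p : Nat.Primes, (p:ℝ) ^ (-(1+ε)) + Real.log ε =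
      (∫ t in Set.Ioi (0:ℝ), Real.exp (-t) * (S (t/ε) - Real.log (t/ε))) -
        Real.eulerMascheroniConstant := by
    intro ε hε
    obtain ⟨h1, h2⟩ := mt_laplace ε hε
    have h3 : MeasureTheory.IntegrableOn (fun t : ℝ => Real.exp (-t) * Real.log t -
      Real.exp (-t) * Real.log ε) (Set.Ioi 0) := mt_int_log.sub (mt_int_exp.mul_const _)
    have h4 : Set.EqOn (fun t : ℝ => Real.exp (-t) * S (t/ε) - (Real.exp (-t) * Real.log t -
      Real.exp (-t) * Real.log ε)) (fun t : ℝ => Real.exp (-t) * (S (t/ε) - Real.log (t/ε)))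
        (Set.Ioi 0) := by
      intro t ht
      have ht : 0 < t := ht
      simp only
      rw [Real.log_div ht.ne' hε.ne']
      ring
    constructor
    · exact MeasureTheory.IntegrableOn.congr_fun (h1.sub h3) h4 measurableSet_Ioi
    · rw [← MeasureTheory.setIntegral_congr_fun measurableSet_Ioi h4,
        MeasureTheory.integral_sub h1 h3,
        MeasureTheory.integral_sub mt_int_log (mt_int_exp.mul_const _),
        MeasureTheory.integral_mul_const, mt_gamma, integral_exp_neg_Ioi_zero, h2]
      ring
  have hlim : Tendsto (fun ε : ℝ => ∫ t in Set.Ioi (0:ℝ), Real.exp (-t) * (S (t/ε) - Real.log (t/ε)))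
      (nhdsWithin 0 (Set.Ioi 0)) (nhds (∫ t in Set.Ioi (0:ℝ), Real.exp (-t) * M)) := by
    apply MeasureTheory.tendsto_integral_filter_of_dominated_convergence
      (fun t => Real.exp (-t) * (|M| + 2 * (K+1) / Real.log 2) + |Real.exp (-t) * Real.log t|)
    · filter_upwards [self_mem_nhdsWithin] with ε hε
      exact (hinteg ε hε).1.aestronglyMeasurable
    · have : Set.Ioo (0:ℝ) 1 ∈ nhdsWithin (0:ℝ) (Set.Ioi 0) := Ioo_mem_nhdsGT (by norm_num)
      filter_upwards [this] with ε hε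
      filter_upwards [MeasureTheory.ae_restrict_mem measurableSet_Ioi] with t ht
      have ht : 0 < t := ht
      have hε0 := hε.1
      have e1 := Real.exp_pos (-t)
      rw [Real.norm_eq_abs, abs_mul, abs_mul, abs_of_pos e1, ← mul_add]
      apply mul_le_mul_of_nonneg_left _ e1.le
      have hM := abs_nonneg M
      have hL := abs_nonneg (Real.log t)
      have hq : 0 < 2 * (K+1) / Real.log 2 := by positivity
      rcases lt_or_ge (t/ε) (Real.log 2) with hlt | hge
      · rw [hS0 _ hlt, zero_sub, abs_neg]
        have hte : t ≤ t / ε := by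
          rw [le_div_iff₀ hε0]; nlinarith [hε.2]
        have h1 : Real.log t ≤ Real.log (t/ε) := Real.log_le_log ht hte
        have h2 : Real.log (t/ε) ≤ 0 := Real.log_nonpos (by positivity) (by linarith)
        rw [abs_of_nonpos h2, abs_of_nonpos (h1.trans h2)]
        linarith
      · have h1 := hSE _ hge
        have h2 : 2 * (K+1) / (t/ε) ≤ 2 * (K+1) / Real.log 2 := by gcongr
        have h3 : |S (t/ε) - Real.log (t/ε)| ≤ |S (t/ε) - Real.log (t/ε) - M| + |M| := by
          have := abs_add_le (S (t/ε) - Real.log (t/ε) - M) M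
          simpa using this
        linarith
    · exact (mt_int_exp.mul_const _).add mt_int_log.abs
    · filter_upwards [MeasureTheory.ae_restrict_mem measurableSet_Ioi] with t ht
      have ht : 0 < t := ht
      apply Tendsto.const_mul
      have hdiv : Tendsto (fun ε : ℝ => t / ε) (nhdsWithin 0 (Set.Ioi 0)) atTop := by
        simp only [div_eq_mul_inv]
        exact tendsto_inv_nhdsGT_zero.const_mul_atTop ht
      have hE : Tendsto (fun u => S u - Real.log u) atTop (nhds M) := by
        rw [tendsto_iff_norm_sub_tendsto_zero]
        refine squeeze_zero' (g := fun u => 2 * (K+1) / u) (Eventually.of_forall fun _ => norm_nonneg _) ?_ ?_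
        · filter_upwards [eventually_ge_atTop (Real.log 2)] with u hu
          exact hSE u hu
        · exact tendsto_const_nhds.div_atTop tendsto_id
      exact hE.comp hdiv
  rw [MeasureTheory.integral_mul_const, integral_exp_neg_Ioi_zero, one_mul] at hlim
  refine (hlim.sub_const Real.eulerMascheroniConstant).congr' ?_
  filter_upwards [self_mem_nhdsWithin] with ε hε
  exact (hinteg ε hε).2.symm

lemma mt_g_bound {y : ℝ} (h0 : 0 ≤ y) (h1 : y ≤ 1/2) : |-Real.log (1 - y) - y| ≤ 2 * y^2 := by
  have h := Real.abs_log_sub_add_sum_range_le (x := y) (by rw [abs_of_nonneg h0]; linarith) 1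
  simp only [Finset.range_one, Finset.sum_singleton, abs_of_nonneg h0] at h
  norm_num at h
  have e : -Real.log (1-y) - y = -(y + Real.log (1-y)) := by ring
  rw [e, abs_neg]
  refine h.trans ?_
  rw [div_le_iff₀ (by linarith)]
  nlinarith [sq_nonneg y]

lemma mt_const {M K : ℝ} (hK : 0 < K) (h : ∀ n : ℕ, 2 ≤ n →
    |∑ p ∈ (n+1).primesBelow, 1 / (p:ℝ) - Real.log (Real.log n) - M| ≤ K / Real.log n) :
    Summable (fun p : Nat.Primes => -Real.log (1 - 1/(p:ℝ)) - 1/(p:ℝ)) ∧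
    M + ∑' p : Nat.Primes, (-Real.log (1 - 1/(p:ℝ)) - 1/(p:ℝ)) = Real.eulerMascheroniConstant := by
  have hp2 : ∀ p : Nat.Primes, (2:ℝ) ≤ p := fun p => by exact_mod_cast p.2.two_le
  have hbs : Summable (fun p : Nat.Primes => 2 * (1/(p:ℝ))^2) := by
    refine ((Nat.Primes.summable_rpow (r := -2)).2 (by norm_num)).mul_left 2 |>.congr fun p => ?_
    have : (0:ℝ) < p := by linarith [hp2 p]
    rw [Real.rpow_neg this.le]
    norm_num
  have hy : ∀ ε : ℝ, 0 ≤ ε → ∀ p : Nat.Primes, 0 ≤ (p:ℝ) ^ (-(1+ε)) ∧ (p:ℝ) ^ (-(1+ε)) ≤ 1/(p:ℝ) ∧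
      1/(p:ℝ) ≤ 1/2 := by
    intro ε hε p
    have := hp2 p
    refine ⟨by positivity, ?_, one_div_le_one_div_of_le (by norm_num) this⟩
    have e : 1/(p:ℝ) = (p:ℝ)^(-1:ℝ) := by rw [Real.rpow_neg_one]; simp
    rw [e]
    exact Real.rpow_le_rpow_of_exponent_le (by linarith) (by linarith)
  have hb : ∀ ε : ℝ, 0 ≤ ε → ∀ p : Nat.Primes,
      ‖-Real.log (1 - (p:ℝ) ^ (-(1+ε))) - (p:ℝ) ^ (-(1+ε))‖ ≤ 2 * (1/(p:ℝ))^2 := by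
    intro ε hε p
    obtain ⟨h0, h1, h2⟩ := hy ε hε p
    refine (mt_g_bound h0 (h1.trans h2)).trans ?_
    gcongr
  have e0 : ∀ p : Nat.Primes, (p:ℝ) ^ (-(1+(0:ℝ))) = 1/(p:ℝ) := fun p => by
    rw [add_zero, Real.rpow_neg_one]; simp
  have hsg : Summable (fun p : Nat.Primes => -Real.log (1 - 1/(p:ℝ)) - 1/(p:ℝ)) := by
    refine Summable.of_norm_bounded hbs fun p => ?_
    have := hb 0 le_rfl p
    rwa [e0] at this
  refine ⟨hsg, ?_⟩
  have hg : Tendsto (fun ε : ℝ => ∑' p : Nat.Primes,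
      (-Real.log (1 - (p:ℝ) ^ (-(1+ε))) - (p:ℝ) ^ (-(1+ε)))) (nhdsWithin 0 (Set.Ioi 0))
      (nhds (∑' p : Nat.Primes, (-Real.log (1 - 1/(p:ℝ)) - 1/(p:ℝ)))) := by
    refine tendsto_tsum_of_dominated_convergence hbs (fun p => ?_) ?_
    · have hp := hp2 p
      have hc : Tendsto (fun ε : ℝ => (p:ℝ) ^ (-(1+ε))) (nhdsWithin 0 (Set.Ioi 0)) (nhds (1/(p:ℝ))) := by
        rw [← e0]
        apply tendsto_nhdsWithin_of_tendsto_nhds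
        have : Continuous (fun ε : ℝ => (p:ℝ) ^ (-(1+ε))) :=
          Continuous.rpow continuous_const (by fun_prop) (fun _ => Or.inl (by linarith))
        exact this.tendsto 0
      have hne : 1 - 1/(p:ℝ) ≠ 0 := by
        have := (hy 0 le_rfl p).2.2
        linarith
      exact ((hc.const_sub 1).log hne).neg.sub hc
    · filter_upwards [self_mem_nhdsWithin] with ε hε
      exact hb ε (le_of_lt hε)
  have hzeta : Tendsto (fun ε : ℝ => Real.log (∑' n : ℕ, 1 / (n:ℝ)^(1+ε)) + Real.log ε)
      (nhdsWithin 0 (Set.Ioi 0)) (nhds 0) := by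
    have hsh : Tendsto (fun ε : ℝ => 1 + ε) (nhdsWithin 0 (Set.Ioi 0)) (nhdsWithin 1 (Set.Ioi 1)) := by
      apply tendsto_nhdsWithin_iff.2
      constructor
      · apply tendsto_nhdsWithin_of_tendsto_nhds
        have : Continuous (fun ε : ℝ => 1 + ε) := by fun_prop
        simpa using this.tendsto 0
      · filter_upwards [self_mem_nhdsWithin] with ε hε
        have : 0 < ε := hε
        simpa using this
    have h1 := (tendsto_sub_mul_tsum_nat_rpow.comp hsh).log one_ne_zero
    rw [Real.log_one] at h1
    refine h1.congr' ?_
    filter_upwards [self_mem_nhdsWithin] with ε hε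
    have hε : 0 < ε := hε
    have hpos : 0 < ∑' n : ℕ, 1 / (n:ℝ)^(1+ε) :=
      (Real.summable_one_div_nat_rpow.2 (by linarith)).tsum_pos (fun n => by positivity) 1 (by simp)
    simp only [Function.comp, add_sub_cancel_left]
    rw [Real.log_mul hε.ne' hpos.ne', add_comm]
  have hsumm := (mt_limit_primes hK h).add hg
  have heq := tendsto_nhds_unique (hsumm.congr' ?_) hzeta
  · linarith
  · filter_upwards [self_mem_nhdsWithin] with ε hε
    have hε : 0 < ε := hε
    have s1 : Summable fun p : Nat.Primes => (p:ℝ) ^ (-(1+ε)) :=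
      Nat.Primes.summable_rpow.2 (by linarith)
    have s2 : Summable fun p : Nat.Primes =>
        (-Real.log (1 - (p:ℝ) ^ (-(1+ε))) - (p:ℝ) ^ (-(1+ε))) :=
      Summable.of_norm_bounded hbs (hb ε hε.le)
    have s3 : Summable fun p : Nat.Primes => -Real.log (1 - (p:ℝ) ^ (-(1+ε))) := by
      refine (s2.add s1).congr fun p => by ring
    rw [← mt_zeta (1+ε) (by linarith) s3, s3.tsum_sub s1]
    ring

lemma mt_tail (r : ℕ → ℝ) (K : ℝ) (hK : 0 ≤ K) (hr : ∀ p : ℕ, p.Prime → |r p| ≤ K / (p:ℝ)^2) :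
    ∃ T, ∀ n : ℕ, 1 ≤ n → |∑ p ∈ (n+1).primesBelow, r p - T| ≤ K / n := by
  have h1 : Tendsto (fun n : ℕ => K / ((n+1:ℕ):ℝ)) atTop (nhds 0) := by
    apply Tendsto.const_div_atTop
    exact tendsto_natCast_atTop_atTop.comp (tendsto_add_atTop_nat 1)
  have h2 : ∀ n : ℕ, |∑ p ∈ (n+1+1+1).primesBelow, r p - ∑ p ∈ (n+1+1).primesBelow, r p| ≤
      K / ((n+1:ℕ):ℝ) - K / ((n+1+1:ℕ):ℝ) := by
    intro n
    have hge : K / ((n+2:ℕ):ℝ)^2 ≤ K / (n+1:ℕ) - K / (n+1+1:ℕ) := by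
      have e : K / (n+1:ℕ) - K / (n+1+1:ℕ) = K / (((n:ℝ)+1) * (n+2)) := by
        push_cast
        field_simp
        ring
      rw [e]
      push_cast
      gcongr
      nlinarith [n.cast_nonneg (α := ℝ)]
    have h0 : 0 ≤ K / ((n+2:ℕ):ℝ)^2 := by positivity
    rw [Nat.primesBelow_succ (n+1+1)]
    split_ifs with hp
    · rw [Finset.sum_insert (Nat.notMem_primesBelow _), add_sub_cancel_right]
      exact (hr _ hp).trans hge
    · simp only [sub_self, abs_zero]
      exact h0.trans hge
  obtain ⟨T, hT⟩ := mt_limit (fun n => ∑ p ∈ (n+1+1).primesBelow, r p)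
    (fun n => K / ((n+1:ℕ):ℝ)) h1 h2
  refine ⟨T, fun n hn => ?_⟩
  obtain ⟨m, rfl⟩ : ∃ m, n = m + 1 := ⟨n - 1, by omega⟩
  exact hT m

lemma mt_tendsto_of_bound {r : ℕ → ℝ} {T K : ℝ}
    (h : ∀ n : ℕ, 1 ≤ n → |∑ p ∈ (n+1).primesBelow, r p - T| ≤ K / n) :
    Tendsto (fun n : ℕ => ∑ p ∈ n.primesBelow, r p) atTop (nhds T) := by
  rw [← tendsto_add_atTop_iff_nat 1, tendsto_iff_norm_sub_tendsto_zero]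
  refine squeeze_zero' (g := fun n : ℕ => K / (n:ℝ)) (Eventually.of_forall fun _ => norm_nonneg _) ?_ ?_
  · filter_upwards [eventually_ge_atTop 1] with n hn
    exact h n hn
  · exact tendsto_const_nhds.div_atTop tendsto_natCast_atTop_atTop

/-- Mertens third theorem, logarithmic form. -/
lemma mt_third : ∃ K : ℝ, 0 < K ∧ ∀ z : ℝ, ∀ n : ℕ, 2 ≤ n → (n:ℝ) ≤ z → z ≤ n + 1 →
    |∑ p ∈ (n+1).primesBelow, -Real.log (1 - 1/(p:ℝ)) - Real.log (Real.log z) -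
      Real.eulerMascheroniConstant| ≤ K / Real.log z := by
  obtain ⟨M, K, hK, h⟩ := mt_second
  obtain ⟨hs, hM⟩ := mt_const hK h
  have hr : ∀ p : ℕ, p.Prime → |-Real.log (1 - 1/(p:ℝ)) - 1/(p:ℝ)| ≤ 2 / (p:ℝ)^2 := by
    intro p hp
    have hp2 : (2:ℝ) ≤ p := by exact_mod_cast hp.two_le
    refine (mt_g_bound (by positivity) (one_div_le_one_div_of_le (by norm_num) hp2)).trans (le_of_eq ?_)
    field_simp
  obtain ⟨T, hT⟩ := mt_tail (fun p => -Real.log (1 - 1/(p:ℝ)) - 1/(p:ℝ)) 2 (by norm_num) hr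
  have hTe : T = ∑' p : Nat.Primes, (-Real.log (1 - 1/(p:ℝ)) - 1/(p:ℝ)) := by
    have h1 := (hasSum_subtype_iff_indicator (s := {p : ℕ | p.Prime})
      (f := fun p : ℕ => -Real.log (1 - 1/(p:ℝ)) - 1/(p:ℝ))).1 hs.hasSum
    have h2 := h1.tendsto_sum_nat
    refine tendsto_nhds_unique (mt_tendsto_of_bound hT) (h2.congr fun n => ?_)
    rw [Nat.primesBelow, Finset.sum_filter]
    refine Finset.sum_congr rfl fun p _ => ?_
    simp [Set.indicator_apply]
  refine ⟨2*(K+1) + 2 * 2, by linarith, fun z n hn2 hn hn' => ?_⟩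
  have hn2' : (2:ℝ) ≤ n := by exact_mod_cast hn2
  have hz : 0 < z := by linarith
  have hlz : 0 < Real.log z := Real.log_pos (by linarith)
  have h1 := mt_E hK h (Real.log z) n hn2 (by rwa [Real.exp_log hz]) (by rwa [Real.exp_log hz])
  have h2 := hT n (by omega)
  have h3 : (2:ℝ) / n ≤ 2 * 2 / Real.log z := by
    rw [div_le_div_iff₀ (by linarith) hlz]
    have := Real.log_le_sub_one_of_pos hz
    linarith
  have e : ∑ p ∈ (n+1).primesBelow, -Real.log (1 - 1/(p:ℝ)) - Real.log (Real.log z) -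
      Real.eulerMascheroniConstant =
      (∑ p ∈ (n+1).primesBelow, 1/(p:ℝ) - Real.log (Real.log z) - M) +
      (∑ p ∈ (n+1).primesBelow, (-Real.log (1 - 1/(p:ℝ)) - 1/(p:ℝ)) - T) := by
    rw [← hM, ← hTe, Finset.sum_sub_distrib]
    ring
  rw [e, add_div]
  exact (abs_add_le _ _).trans (add_le_add h1 (h2.trans h3))

lemma mt_a_bounds {p : ℕ} (hp : p.Prime) :
    0 ≤ ((p : ℝ) ^ 2 - p - 1) / (((p : ℝ) - 1) ^ 3 * ((p : ℝ) + 1)) ∧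
    ((p : ℝ) ^ 2 - p - 1) / (((p : ℝ) - 1) ^ 3 * ((p : ℝ) + 1)) ≤ 1/2 ∧
    ((p : ℝ) ^ 2 - p - 1) / (((p : ℝ) - 1) ^ 3 * ((p : ℝ) + 1)) ≤ 4 / (p:ℝ)^2 := by
  have hp2 : (2:ℝ) ≤ p := by exact_mod_cast hp.two_le
  obtain ⟨x, hx⟩ : ∃ x : ℝ, (p:ℝ) = x + 2 := ⟨p - 2, by ring⟩
  have hx0 : 0 ≤ x := by linarith
  rw [hx]
  have hd : 0 < (x + 2 - 1)^3 * (x + 2 + 1) := by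
    have : x + 2 - 1 = x + 1 := by ring
    rw [this]; positivity
  have := pow_nonneg hx0 2
  have := pow_nonneg hx0 3
  have := pow_nonneg hx0 4
  refine ⟨div_nonneg (by nlinarith) hd.le, ?_, ?_⟩
  · rw [div_le_div_iff₀ hd (by norm_num)]
    nlinarith
  · rw [div_le_div_iff₀ hd (by positivity)]
    nlinarith

lemma mt_factor {p : ℕ} (hp : p.Prime) :
    1 - ((p : ℝ) ^ 2 - 2) / (((p : ℝ) - 1) * ((p : ℝ) ^ 2 - 1)) =
    (1 - 1/(p:ℝ)) * (1 - ((p : ℝ) ^ 2 - p - 1) / (((p : ℝ) - 1) ^ 3 * ((p : ℝ) + 1))) := by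
  have hp2 : (2:ℝ) ≤ p := by exact_mod_cast hp.two_le
  have h1 : (p:ℝ) - 1 ≠ 0 := by linarith
  have h2 : (p:ℝ) + 1 ≠ 0 := by linarith
  have h3 : (p:ℝ) ≠ 0 := by linarith
  have e : (p:ℝ)^2 - 1 = (p - 1) * (p + 1) := by ring
  rw [e]
  field_simp
  ring

/-- The product `C := ∏_p (1 - (p²-p-1)/((p-1)³(p+1)))` over all primes converges to a
positive real number, and `∏_{p<z} (1 - (p²-2)/((p-1)(p²-1))) = (C e^{-γ}/log z)(1 + O(1/log z))`:
there are `A > 0` and `z₀` such that for all `z ≥ z₀`,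
`|∏_{p<z} (1 - (p²-2)/((p-1)(p²-1))) - C e^{-γ}/log z| ≤ A C e^{-γ}/(log z)²`. -/
theorem stmt13 :
    ∃ C : ℝ, 0 < C ∧
      Tendsto (fun n : ℕ => ∏ p ∈ n.primesBelow,
          (1 - ((p : ℝ) ^ 2 - p - 1) / (((p : ℝ) - 1) ^ 3 * ((p : ℝ) + 1))))
        atTop (nhds C) ∧
      ∃ A : ℝ, 0 < A ∧ ∃ z₀ : ℝ, ∀ z : ℝ, z₀ ≤ z →
        |(∏ p ∈ (Nat.ceil z).primesBelow,
            (1 - ((p : ℝ) ^ 2 - 2) / (((p : ℝ) - 1) * ((p : ℝ) ^ 2 - 1))))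
          - C * Real.exp (-Real.eulerMascheroniConstant) / Real.log z|
        ≤ A * C * Real.exp (-Real.eulerMascheroniConstant) / (Real.log z) ^ 2 := by
  set a : ℕ → ℝ := fun p => ((p : ℝ) ^ 2 - p - 1) / (((p : ℝ) - 1) ^ 3 * ((p : ℝ) + 1)) with ha
  have hab : ∀ p : ℕ, p.Prime → 0 ≤ a p ∧ a p ≤ 1/2 ∧ a p ≤ 4 / (p:ℝ)^2 := fun p hp => mt_a_bounds hp
  have hr : ∀ p : ℕ, p.Prime → |Real.log (1 - a p)| ≤ 8 / (p:ℝ)^2 := by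
    intro p hp
    obtain ⟨h0, h1, h2⟩ := hab p hp
    have h3 := abs_le.1 (mt_g_bound h0 h1)
    have e : 8 / (p:ℝ)^2 = 2 * (4 / (p:ℝ)^2) := by ring
    have h4 : 2 * (a p)^2 ≤ a p := by nlinarith
    rw [abs_le]
    constructor
    · linarith
    · linarith
  obtain ⟨T, hT⟩ := mt_tail (fun p => Real.log (1 - a p)) 8 (by norm_num) hr
  have hprod : ∀ n : ℕ, ∏ p ∈ n.primesBelow, (1 - a p) =
      Real.exp (∑ p ∈ n.primesBelow, Real.log (1 - a p)) := by
    intro n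
    rw [Real.exp_sum]
    refine Finset.prod_congr rfl fun p hp => ?_
    have := (hab p (Nat.mem_primesBelow.1 hp).2).2.1
    rw [Real.exp_log (by linarith)]
  refine ⟨Real.exp T, Real.exp_pos _, ?_, ?_⟩
  · have := (Real.continuous_exp.tendsto T).comp (mt_tendsto_of_bound hT)
    exact this.congr fun n => (hprod n).symm
  obtain ⟨K, hK, h⟩ := mt_third
  set B := K + 16 with hB
  refine ⟨2 * B, by linarith, max 4 (Real.exp B), fun z hz => ?_⟩
  have hz4 : 4 ≤ z := (le_max_left _ _).trans hz
  have hzB : B ≤ Real.log z :=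
    (Real.le_log_iff_exp_le (by linarith)).2 ((le_max_right _ _).trans hz)
  have hlz : 0 < Real.log z := by linarith
  have hz0 : 0 < z := by linarith
  obtain ⟨n, hn⟩ : ∃ n, ⌈z⌉₊ = n + 1 := ⟨⌈z⌉₊ - 1, by
    have : 0 < ⌈z⌉₊ := Nat.ceil_pos.2 hz0
    omega⟩
  have hz1 : z ≤ n + 1 := by
    have := Nat.le_ceil z
    rw [hn] at this
    exact_mod_cast this
  have hz2 : (n:ℝ) ≤ z := by
    have := Nat.ceil_lt_add_one hz0.le
    rw [hn] at this
    push_cast at this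
    linarith
  have hn2 : 2 ≤ n := by
    have : (2:ℝ) ≤ n := by linarith
    exact_mod_cast this
  have hn0 : (0:ℝ) < n := by positivity
  rw [hn]
  have h1 := h z n hn2 hz2 hz1
  have h2 := hT n (by omega)
  have h3 : (8:ℝ) / n ≤ 16 / Real.log z := by
    rw [div_le_div_iff₀ hn0 hlz]
    have := Real.log_le_sub_one_of_pos hz0
    linarith
  set P := ∑ p ∈ (n+1).primesBelow, -Real.log (1 - 1/(p:ℝ)) with hP
  set Q := ∑ p ∈ (n+1).primesBelow, Real.log (1 - a p) with hQ
  set γ := Real.eulerMascheroniConstant with hγ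
  have hmain : ∏ p ∈ (n+1).primesBelow,
      (1 - ((p : ℝ) ^ 2 - 2) / (((p : ℝ) - 1) * ((p : ℝ) ^ 2 - 1))) = Real.exp (Q - P) := by
    rw [Finset.prod_congr rfl fun p hp => mt_factor (Nat.mem_primesBelow.1 hp).2,
      Finset.prod_mul_distrib]
    have e1 : ∏ p ∈ (n+1).primesBelow, (1 - 1/(p:ℝ)) = Real.exp (-P) := by
      rw [hP, Finset.sum_neg_distrib, neg_neg, Real.exp_sum]
      refine Finset.prod_congr rfl fun p hp => ?_
      have : (2:ℝ) ≤ p := by exact_mod_cast (Nat.mem_primesBelow.1 hp).2.two_le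
      have : 1/(p:ℝ) ≤ 1/2 := one_div_le_one_div_of_le (by norm_num) this
      rw [Real.exp_log (by linarith)]
    have e2 := hprod (n+1)
    simp only [ha] at e2
    rw [e1, e2, ← Real.exp_add]
    congr 1
    simp only [hQ, ha]
    ring
  set δ := (Q - T) - (P - Real.log (Real.log z) - γ) with hδ
  have hδb : |δ| ≤ B / Real.log z := by
    rw [hB, add_div]
    refine (abs_sub _ _).trans ?_
    linarith
  have hδ1 : |δ| ≤ 1 := hδb.trans ((div_le_one hlz).2 hzB)
  have hexp := Real.abs_exp_sub_one_le hδ1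
  have hQP : Real.exp (Q - P) = Real.exp T * Real.exp (-γ) / Real.log z * Real.exp δ := by
    have e : Q - P = T + (-γ) + -Real.log (Real.log z) + δ := by rw [hδ]; ring
    rw [e, Real.exp_add, Real.exp_add, Real.exp_add, Real.exp_neg (Real.log _), Real.exp_log hlz]
    ring
  rw [hmain, hQP]
  set m := Real.exp T * Real.exp (-γ) / Real.log z with hm
  have hm0 : 0 < m := by positivity
  have e : m * Real.exp δ - m = m * (Real.exp δ - 1) := by ring
  rw [e, abs_mul, abs_of_pos hm0]
  calc m * |Real.exp δ - 1| ≤ m * (2 * (B / Real.log z)) := by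
        apply mul_le_mul_of_nonneg_left _ hm0.le
        linarith
    _ = _ := by rw [hm]; field_simp
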